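/- arXiv:1802.06145 — 8 statements merged into one kernel-verified Lean document; each statement's English description precedes it below -/
import Mathlib

section
/- Let n ≥ 1 be an integer and let f : A → B be an injective homomorphism of abelian groups such that A and B are both n-torsion. Then the following are equivalent: (1) the image f(A) is a direct summand of B; (2) f preserves divisibility, i.e., for every integer m ≥ 1 and every a ∈ A, if f(a) is divisible by m in B then a is divisible by m in A; (3) f preserves n-divisibility, i.e., the condition in (2) holds for every m dividing n. -/
/-- A subgroup `S` of a group of exponent dividing `n` which is `n`-pure modulo some subgroup `C`
stays `n`-pure modulo a larger subgroup, unless `S` and `C` already span. -/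
theorem AddSubgroup.exists_gt_pure_modulo {B : Type*} [AddCommGroup B] {n : ℕ} (hn : n ≠ 0)
    (hB : ∀ b : B, n • b = 0) {S C : AddSubgroup B}
    (hC : ∀ m : ℕ, m ∣ n → ∀ s ∈ S, ∀ b : B, s - m • b ∈ C → ∃ s' ∈ S, s = m • s')
    (hSC : S ⊔ C ≠ ⊤) :
    ∃ C' > C, ∀ m : ℕ, m ∣ n → ∀ s ∈ S, ∀ b : B, s - m • b ∈ C' → ∃ s' ∈ S, s = m • s' := by
  have hQ : ∀ q : B ⧸ (S ⊔ C), n • q = 0 := by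
    intro q
    obtain ⟨b, rfl⟩ := QuotientAddGroup.mk_surjective q
    rw [← QuotientAddGroup.mk_nsmul, hB, QuotientAddGroup.mk_zero]
  obtain ⟨q, hq⟩ := AddMonoid.exists_addOrderOf_eq_exponent
    (G := B ⧸ (S ⊔ C)) ⟨n, Nat.pos_of_ne_zero hn, hQ⟩
  set e := AddMonoid.exponent (B ⧸ (S ⊔ C)) with he
  have hen : e ∣ n := AddMonoid.exponent_dvd_of_forall_nsmul_eq_zero hQ
  have he1 : e ≠ 1 := by
    intro h
    have := AddMonoid.exp_eq_one_iff.1 h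
    exact hSC (QuotientAddGroup.subsingleton_iff.1 this)
  obtain ⟨b₀, rfl⟩ := QuotientAddGroup.mk_surjective q
  -- Correct `b₀` by an element of `S` so that its multiple by `e` lands in `C`.
  obtain ⟨b, hb, heb⟩ : ∃ b : B, addOrderOf (b : B ⧸ (S ⊔ C)) = e ∧ e • b ∈ C := by
    have h0 : e • b₀ ∈ S ⊔ C := by
      rw [← QuotientAddGroup.eq_zero_iff, QuotientAddGroup.mk_nsmul, ← hq,
        addOrderOf_nsmul_eq_zero]
    obtain ⟨s, hs, c, hc, hsc⟩ := AddSubgroup.mem_sup.1 h0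
    obtain ⟨s', hs', rfl⟩ := hC e hen s hs b₀ (by
      rw [← hsc]; simpa using hc)
    refine ⟨b₀ - s', ?_, ?_⟩
    · rw [QuotientAddGroup.mk_sub,
        (QuotientAddGroup.eq_zero_iff s').2 (AddSubgroup.mem_sup_left hs'), sub_zero, hq]
    · rw [smul_sub, ← hsc]; simpa using hc
  refine ⟨C ⊔ AddSubgroup.zmultiples b, ?_, ?_⟩
  · refine lt_of_le_of_ne le_sup_left fun h ↦ he1 ?_
    have hbC : b ∈ C := h ▸ AddSubgroup.mem_sup_right (AddSubgroup.mem_zmultiples b)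
    rw [← hb, AddMonoid.addOrderOf_eq_one_iff, QuotientAddGroup.eq_zero_iff]
    exact AddSubgroup.mem_sup_right hbC
  · intro m hm s hs x hx
    obtain ⟨c, hc, y, hy, hcy⟩ := AddSubgroup.mem_sup.1 hx
    obtain ⟨j, rfl⟩ := AddSubgroup.mem_zmultiples_iff.1 hy
    have hj : j • (b : B ⧸ (S ⊔ C)) = -(m • (x : B ⧸ (S ⊔ C))) := by
      rw [← QuotientAddGroup.mk_zsmul, ← QuotientAddGroup.mk_nsmul, ← QuotientAddGroup.mk_neg,
        ← sub_eq_zero, ← QuotientAddGroup.mk_sub, QuotientAddGroup.eq_zero_iff]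
      have : j • b - -(m • x) = s - c := by
        rw [sub_neg_eq_add, ← sub_eq_iff_eq_add'.2 hcy.symm]; abel
      rw [this]
      exact sub_mem (AddSubgroup.mem_sup_left hs) (AddSubgroup.mem_sup_right hc)
    have hgj : ((Nat.gcd m e : ℕ) : ℤ) ∣ j := by
      obtain ⟨k, hk⟩ := Nat.gcd_dvd_right m e
      obtain ⟨l, hl⟩ := Nat.gcd_dvd_left m e
      have he0 : e ≠ 0 := fun h ↦ hn (by simpa [h] using hen)
      have hk0 : k ≠ 0 := by rintro rfl; exact he0 (by simpa using hk)
      have hkm : k * m = l * e := by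
        calc k * m = k * (m.gcd e * l) := by rw [← hl]
          _ = l * (m.gcd e * k) := by ring
          _ = l * e := by rw [← hk]
      have h1 : ((k : ℤ) * j) • (b : B ⧸ (S ⊔ C)) = 0 := by
        rw [mul_zsmul, hj, natCast_zsmul, smul_neg, ← mul_nsmul', hkm, mul_nsmul',
          AddMonoid.exponent_nsmul_eq_zero, smul_zero, neg_zero]
      have h2 := addOrderOf_dvd_iff_zsmul_eq_zero.2 h1
      rw [hb, hk, Nat.cast_mul, mul_comm (k : ℤ)] at h2
      exact Int.dvd_of_mul_dvd_mul_right (by exact_mod_cast hk0) h2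
    obtain ⟨r, hr⟩ := hgj
    have hjb : j • b = m • ((m.gcdA e * r) • b) + (m.gcdB e * r) • (e • b) := by
      rw [hr, Nat.gcd_eq_gcd_ab, ← natCast_zsmul, ← natCast_zsmul, ← mul_zsmul, ← mul_zsmul,
        ← add_zsmul]
      congr 1; ring
    refine hC m hm s hs (x + (m.gcdA e * r) • b) ?_
    have : s - m • (x + (m.gcdA e * r) • b) = c + (m.gcdB e * r) • (e • b) := by
      rw [smul_add, ← sub_sub, ← hcy, hjb]; abel
    rw [this]
    exact add_mem hc (zsmul_mem heb _)

/-- An `n`-pure subgroup of an `n`-torsion abelian group has a complement. -/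
theorem AddSubgroup.exists_isCompl_of_pure {B : Type*} [AddCommGroup B] {n : ℕ} (hn : n ≠ 0)
    (hB : ∀ b : B, n • b = 0) {S : AddSubgroup B}
    (hS : ∀ m : ℕ, m ∣ n → ∀ b : B, m • b ∈ S → ∃ s ∈ S, m • b = m • s) :
    ∃ C : AddSubgroup B, IsCompl S C := by
  obtain ⟨C, hC⟩ := zorn_le₀ {C : AddSubgroup B | ∀ m : ℕ, m ∣ n → ∀ s ∈ S, ∀ b : B,
      s - m • b ∈ C → ∃ s' ∈ S, s = m • s'} (by
    intro c hc hchain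
    rcases c.eq_empty_or_nonempty with rfl | hne
    · refine ⟨⊥, fun m hm s hs b hb ↦ ?_, by simp⟩
      obtain rfl := sub_eq_zero.1 (AddSubgroup.mem_bot.1 hb)
      exact hS m hm b hs
    · refine ⟨sSup c, fun m hm s hs b hb ↦ ?_, fun _ ↦ le_sSup⟩
      obtain ⟨D, hD, hbD⟩ := (AddSubgroup.mem_sSup_of_directedOn hne hchain.directedOn).1 hb
      exact hc hD m hm s hs b hbD)
  refine ⟨C, AddSubgroup.disjoint_def.2 fun {s} hs hsC ↦ ?_, codisjoint_iff.2 ?_⟩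
  · obtain ⟨s', -, rfl⟩ := hC.prop n dvd_rfl s hs 0 (by simpa using hsC)
    exact hB s'
  · by_contra h
    obtain ⟨C', hlt, hC'⟩ := AddSubgroup.exists_gt_pure_modulo hn hB hC.prop h
    exact hC.not_gt hC' hlt


/-- **Lemma 2.2 (Gillibert–Gillibert–Gillibert–Ranieri).**
For an injective homomorphism `f : A → B` of `n`-torsion abelian groups, the
following are equivalent: (1) the image of `f` is a direct summand of `B`;
(2) `f` preserves divisibility; (3) `f` preserves `n`-divisibility. -/
theorem image_direct_summand_tfae (n : ℕ) (hn : 1 ≤ n)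
    {A B : Type*} [AddCommGroup A] [AddCommGroup B]
    (f : A →+ B) (hf : Function.Injective f)
    (hA : ∀ a : A, n • a = 0) (hB : ∀ b : B, n • b = 0) :
    List.TFAE
      [ ∃ C : AddSubgroup B, f.range ⊔ C = ⊤ ∧ f.range ⊓ C = ⊥,
        ∀ m : ℕ, 1 ≤ m → ∀ a : A, (∃ b : B, f a = m • b) → ∃ a' : A, a = m • a',
        ∀ m : ℕ, m ∣ n → ∀ a : A, (∃ b : B, f a = m • b) → ∃ a' : A, a = m • a' ] := by
  tfae_have 1 → 2 := by
    rintro ⟨C, hsup, hinf⟩ m - a ⟨b, hab⟩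
    obtain ⟨_, ⟨a', rfl⟩, c, hc, rfl⟩ := AddSubgroup.mem_sup.1 (hsup ▸ AddSubgroup.mem_top b)
    have hmem : f (a - m • a') ∈ f.range ⊓ C := by
      refine ⟨⟨_, rfl⟩, ?_⟩
      rw [map_sub, map_nsmul, hab, smul_add, add_sub_cancel_left]
      exact nsmul_mem hc m
    rw [hinf, AddSubgroup.mem_bot, map_eq_zero_iff f hf, sub_eq_zero] at hmem
    exact ⟨a', hmem⟩
  tfae_have 2 → 3 := fun h m hm ↦ h m (Nat.pos_of_dvd_of_pos hm hn)
  tfae_have 3 → 1 := by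
    intro h
    obtain ⟨C, hC⟩ := AddSubgroup.exists_isCompl_of_pure (Nat.ne_of_gt hn) hB (S := f.range) (by
      rintro m hm b ⟨a, hab⟩
      obtain ⟨a', rfl⟩ := h m hm a ⟨b, hab⟩
      exact ⟨f a', ⟨a', rfl⟩, by rw [← hab, map_nsmul]⟩)
    exact ⟨C, hC.sup_eq_top, hC.inf_eq_bot⟩
  tfae_finish
end

section
/- Let n ≥ 1 be an integer. Let A, B, C, B', C' be abelian groups with homomorphisms f : A → B, g : B → C, g' : B' → C', β : B → B', γ : C → C' satisfying γ ∘ g = g' ∘ β. Assume: (1) B and B' are n-torsion; (2) β is injective; (3) γ preserves n-divisibility; (4) every element c ∈ C with n·c = 0 lies in the image of g; (5) the kernel of g is contained in the image of f; (6) the composite β ∘ f preserves n-divisibility. Then the image β(B) is a direct summand of B'. -/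
/-- In a bounded abelian group, if `k • y` is divisible by `m` for some `y` of maximal order
`e`, then `k` is an integral combination of `m` and `e`. -/
theorem exists_eq_mul_add_mul_of_zsmul_eq_nsmul {H : Type*} [AddCommGroup H] {y : H}
    (hy : addOrderOf y = AddMonoid.exponent H) (hpos : 0 < addOrderOf y)
    {k : ℤ} {m : ℕ} {x : H} (h : k • y = m • x) :
    ∃ l j : ℤ, k = m * l + addOrderOf y * j := by
  set e := addOrderOf y with he
  obtain ⟨q, hq⟩ := Nat.gcd_dvd_right m e
  obtain ⟨r, hr⟩ := Nat.gcd_dvd_left m e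
  have hzero : ((q : ℤ) * k) • y = 0 := by
    have hqm : q * m = r * e := by
      calc q * m = q * (m.gcd e * r) := congrArg (q * ·) hr
        _ = r * (m.gcd e * q) := by ring
        _ = r * e := congrArg (r * ·) hq.symm
    rw [mul_zsmul, h, natCast_zsmul, ← mul_nsmul', hqm, mul_nsmul', hy,
      AddMonoid.exponent_nsmul_eq_zero, nsmul_zero]
  have hdvd : (e : ℤ) ∣ q * k := addOrderOf_dvd_iff_zsmul_eq_zero.mpr hzero
  have hq0 : (q : ℤ) ≠ 0 := by
    intro h0
    have : q = 0 := by exact_mod_cast h0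
    rw [this, mul_zero] at hq
    omega
  have hgk : ((m.gcd e : ℕ) : ℤ) ∣ k := by
    have hcast : (e : ℤ) = q * (m.gcd e : ℕ) := by
      rw [mul_comm]
      exact_mod_cast hq
    rw [hcast] at hdvd
    exact Int.dvd_of_mul_dvd_mul_left hq0 hdvd
  obtain ⟨t, ht⟩ := hgk
  refine ⟨Nat.gcdA m e * t, Nat.gcdB m e * t, ?_⟩
  rw [ht, Nat.gcd_eq_gcd_ab]
  ring

/-- A pure subgroup of a bounded abelian group is a direct summand. -/
theorem AddSubgroup.exists_sup_eq_top_inf_eq_bot_of_pure {G : Type*} [AddCommGroup G] {n : ℕ}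
    (hn : n ≠ 0) (hG : ∀ x : G, n • x = 0) (S : AddSubgroup G)
    (hS : ∀ m : ℕ, m ∣ n → ∀ x : G, m • x ∈ S → ∃ s ∈ S, m • x = m • s) :
    ∃ C : AddSubgroup G, S ⊔ C = ⊤ ∧ S ⊓ C = ⊥ := by
  let P : Set (AddSubgroup G) :=
    {C | ∀ m : ℕ, m ∣ n → ∀ x : G, ∀ c ∈ C, m • x + c ∈ S → ∃ s ∈ S, m • x + c = m • s}
  have hbot : ⊥ ∈ P := by
    intro m hm x c hc hx
    obtain rfl := AddSubgroup.mem_bot.mp hc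
    simpa using hS m hm x (by simpa using hx)
  obtain ⟨C, -, hC⟩ := zorn_le_nonempty₀ P (fun c hcP hc y hy => by
    refine ⟨sSup c, ?_, fun z hz => le_sSup hz⟩
    intro m hm x d hd hx
    obtain ⟨D, hDc, hdD⟩ := (AddSubgroup.mem_sSup_of_directedOn ⟨y, hy⟩ hc.directedOn).mp hd
    exact hcP hDc m hm x d hdD hx) ⊥ hbot
  refine ⟨C, ?_, ?_⟩
  · have hnQ : ∀ x : G ⧸ (S ⊔ C), n • x = 0 := by
      intro x
      induction x using QuotientAddGroup.induction_on with
      | H z => rw [← QuotientAddGroup.mk_nsmul, hG, QuotientAddGroup.mk_zero]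
    obtain ⟨ybar, hy⟩ := AddMonoid.exists_addOrderOf_eq_exponent
      (G := G ⧸ (S ⊔ C)) ⟨n, Nat.pos_of_ne_zero hn, hnQ⟩
    have hen : addOrderOf ybar ∣ n := addOrderOf_dvd_of_nsmul_eq_zero (hnQ ybar)
    have hpos : 0 < addOrderOf ybar := Nat.pos_of_dvd_of_pos hen (Nat.pos_of_ne_zero hn)
    obtain ⟨y₀, rfl⟩ := QuotientAddGroup.mk_surjective ybar
    set e := addOrderOf (y₀ : G ⧸ (S ⊔ C)) with he
    have hey : e • y₀ ∈ S ⊔ C := by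
      rw [← QuotientAddGroup.eq_zero_iff, QuotientAddGroup.mk_nsmul]
      exact addOrderOf_nsmul_eq_zero _
    obtain ⟨s, hs, c, hc, hsc⟩ := AddSubgroup.mem_sup.mp hey
    obtain ⟨s', hs', hss⟩ := hC.prop e hen y₀ (-c) (neg_mem hc) (by
      rw [← hsc]
      simpa using hs)
    set y := y₀ - s' with hydef
    have hyC : e • y ∈ C := by
      have : e • y = c := by
        rw [hydef, nsmul_sub, ← hss]
        abel
      rwa [this]
    have hmk : (y : G ⧸ (S ⊔ C)) = y₀ := by
      rw [QuotientAddGroup.eq]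
      have : -y + y₀ = s' := by
        rw [hydef]
        abel
      rw [this]
      exact AddSubgroup.mem_sup_left hs'
    have hD : C ⊔ AddSubgroup.zmultiples y ∈ P := by
      intro m hm x d hd hx
      obtain ⟨c₁, hc₁, z, hz, rfl⟩ := AddSubgroup.mem_sup.mp hd
      obtain ⟨k, rfl⟩ := AddSubgroup.mem_zmultiples_iff.mp hz
      have hk : k • (y₀ : G ⧸ (S ⊔ C)) = m • ((-x : G) : G ⧸ (S ⊔ C)) := by
        rw [← hmk, ← QuotientAddGroup.mk_zsmul, ← QuotientAddGroup.mk_nsmul,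
          eq_comm, QuotientAddGroup.eq]
        have : -(m • -x) + k • y = (m • x + (c₁ + k • y)) + -c₁ := by
          rw [smul_neg]
          abel
        rw [this]
        exact add_mem (AddSubgroup.mem_sup_left hx) (AddSubgroup.mem_sup_right (neg_mem hc₁))
      obtain ⟨l, j, hlj⟩ := exists_eq_mul_add_mul_of_zsmul_eq_nsmul hy hpos hk
      have hrw : m • x + (c₁ + k • y) = m • (x + l • y) + (c₁ + j • (e • y)) := by
        rw [hlj, ← natCast_zsmul y e, ← natCast_zsmul x m, ← natCast_zsmul (x + l • y) m]
        module
      rw [hrw] at hx ⊢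
      exact hC.prop m hm _ _ (add_mem hc₁ (zsmul_mem hyC j)) hx
    have hymem : y ∈ C :=
      hC.le_of_ge hD le_sup_left
        (AddSubgroup.mem_sup_right (AddSubgroup.mem_zmultiples y))
    have hy0 : (y₀ : G ⧸ (S ⊔ C)) = 0 := by
      rw [← hmk, QuotientAddGroup.eq_zero_iff]
      exact AddSubgroup.mem_sup_right hymem
    rw [he, hy0, addOrderOf_zero] at hy
    have hsub := AddMonoid.exp_eq_one_iff.mp hy.symm
    rw [eq_top_iff]
    intro x _
    exact (QuotientAddGroup.eq_zero_iff x).mp (Subsingleton.elim _ _)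
  · rw [eq_bot_iff]
    rintro x ⟨hxS, hxC⟩
    obtain ⟨s, -, hs⟩ := hC.prop n dvd_rfl 0 x hxC (by simpa using hxS)
    simpa [hG] using hs

/-- **Lemma 2.3 (Gillibert–Gillibert–Gillibert–Ranieri).**
Given a commutative square `γ ∘ g = g' ∘ β` together with a map `f : A → B`,
where `B` and `B'` are `n`-torsion, `β` is injective, `γ` preserves
`n`-divisibility, `C[n] ⊆ im g`, `ker g ⊆ im f`, and `β ∘ f` preserves
`n`-divisibility, the image of `β` is a direct summand of `B'`. -/
theorem image_beta_direct_summand (n : ℕ) (hn : 1 ≤ n)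
    {A B C B' C' : Type*} [AddCommGroup A] [AddCommGroup B] [AddCommGroup C]
    [AddCommGroup B'] [AddCommGroup C']
    (f : A →+ B) (g : B →+ C) (g' : B' →+ C') (β : B →+ B') (γ : C →+ C')
    (hcomm : ∀ b : B, γ (g b) = g' (β b))
    (hB : ∀ b : B, n • b = 0) (hB' : ∀ b' : B', n • b' = 0)
    (hβ : Function.Injective β)
    (hγ : ∀ m : ℕ, m ∣ n → ∀ c : C, (∃ c' : C', γ c = m • c') → ∃ c₀ : C, c = m • c₀)
    (h4 : ∀ c : C, n • c = 0 → ∃ b : B, g b = c)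
    (h5 : ∀ b : B, g b = 0 → ∃ a : A, f a = b)
    (h6 : ∀ m : ℕ, m ∣ n → ∀ a : A, (∃ b' : B', β (f a) = m • b') → ∃ a' : A, a = m • a') :
    ∃ C₀ : AddSubgroup B', β.range ⊔ C₀ = ⊤ ∧ β.range ⊓ C₀ = ⊥ := by
  refine β.range.exists_sup_eq_top_inf_eq_bot_of_pure (by omega) hB' ?_
  rintro m ⟨q, rfl⟩ b' ⟨b, hb⟩
  have hqb : q • b = 0 := hβ (by
    rw [map_nsmul, hb, ← mul_nsmul, hB', map_zero])
  obtain ⟨c, hc⟩ := hγ m (dvd_mul_right m q) (g b)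
    ⟨g' b', by rw [hcomm, hb, map_nsmul]⟩
  obtain ⟨b₀, rfl⟩ := h4 c (by rw [mul_nsmul, ← hc, ← map_nsmul, hqb, map_zero])
  obtain ⟨a, ha⟩ := h5 (b - m • b₀) (by rw [map_sub, map_nsmul, hc, sub_self])
  obtain ⟨a', rfl⟩ := h6 m (dvd_mul_right m q) a
    ⟨b' - β b₀, by rw [ha, map_sub, map_nsmul, hb, nsmul_sub]⟩
  refine ⟨β (b₀ + f a'), ⟨_, rfl⟩, ?_⟩
  rw [← hb, ← map_nsmul, nsmul_add, ← map_nsmul f, ha, add_sub_cancel]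
end

section
/- Let n ≥ 1 be an integer and let f : A → B be a homomorphism of abelian groups such that A and B are both n-torsion. Suppose there exist an integer m dividing n and an element P ∈ A such that: (i) P is not divisible by m in A, but f(P) is divisible by m in B; (ii) every element of the kernel of f is divisible by m in A. Then the image f(A) is not a direct summand of B. -/
/-- **Lemma 3.1 (Gillibert–Gillibert–Gillibert–Ranieri).**
Let `f : A → B` be a homomorphism of `n`-torsion abelian groups. If there are
`m ∣ n` and `P ∈ A` such that (i) `P` is not `m`-divisible in `A` but `f P` is
`m`-divisible in `B`, and (ii) every element of `ker f` is `m`-divisible in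
`A`, then the image of `f` is not a direct summand of `B`. -/
theorem image_not_direct_summand (n : ℕ) (hn : 1 ≤ n)
    {A B : Type*} [AddCommGroup A] [AddCommGroup B]
    (f : A →+ B) (hA : ∀ a : A, n • a = 0) (hB : ∀ b : B, n • b = 0)
    (m : ℕ) (hm : m ∣ n) (P : A)
    (hP1 : ¬ ∃ a : A, P = m • a) (hP2 : ∃ b : B, f P = m • b)
    (hker : ∀ a : A, f a = 0 → ∃ a' : A, a = m • a') :
    ¬ ∃ C : AddSubgroup B, f.range ⊔ C = ⊤ ∧ f.range ⊓ C = ⊥ := by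
  rintro ⟨C, hsup, hinf⟩
  obtain ⟨b, hb⟩ := hP2
  have hmem : b ∈ f.range ⊔ C := hsup ▸ AddSubgroup.mem_top b
  obtain ⟨_, ⟨a, rfl⟩, c, hc, rfl⟩ := AddSubgroup.mem_sup.mp hmem
  have hf : f (P - m • a) = m • c := by
    rw [map_sub, map_nsmul, hb, smul_add, add_sub_cancel_left]
  have hzero : f (P - m • a) ∈ f.range ⊓ C :=
    ⟨⟨_, rfl⟩, hf ▸ C.nsmul_mem hc m⟩
  rw [hinf, AddSubgroup.mem_bot] at hzero
  obtain ⟨a', ha'⟩ := hker _ hzero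
  exact hP1 ⟨a' + a, by rw [smul_add, ← ha', sub_add_cancel]⟩
end

section
/- Let p be a prime number with p ≡ 2 (mod 3), and let g be the matrix [[1,−3],[1,−2]] viewed in GL₂(ℤ/p²ℤ). Then g·H₂·g⁻¹ = H₂, i.e., for every h ∈ H₂ one has g·h·g⁻¹ ∈ H₂ and g⁻¹·h·g ∈ H₂. Consequently H₂ is a normal subgroup of G₂, the subgroup of GL₂(ℤ/p²ℤ) generated by g and H₂. -/
/-- The matrix `h(a,b)` over `ℤ/p²ℤ`. -/
def hmat (p : ℕ) (a b : ZMod (p ^ 2)) : Matrix (Fin 2) (Fin 2) (ZMod (p ^ 2)) :=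
  !![1 + (p : ZMod (p ^ 2)) * (a - 2 * b), 3 * (p : ZMod (p ^ 2)) * (b - a);
     -((p : ZMod (p ^ 2)) * b), 1 - (p : ZMod (p ^ 2)) * (a - 2 * b)]

/-- `H₂ = {h(a,b) : a, b ∈ ℤ/p²ℤ}`, seen inside `GL₂(ℤ/p²ℤ)`. -/
def H2set (p : ℕ) : Set ((Matrix (Fin 2) (Fin 2) (ZMod (p ^ 2)))ˣ) :=
  {u | ∃ a b : ZMod (p ^ 2), (u : Matrix (Fin 2) (Fin 2) (ZMod (p ^ 2))) = hmat p a b}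

/-- `G₂`, the subgroup of `GL₂(ℤ/p²ℤ)` generated by `g` and `H₂`. -/
def G2 (p : ℕ) (g : (Matrix (Fin 2) (Fin 2) (ZMod (p ^ 2)))ˣ) :
    Subgroup ((Matrix (Fin 2) (Fin 2) (ZMod (p ^ 2)))ˣ) :=
  Subgroup.closure ({g} ∪ H2set p)

theorem natCast_mul_self_eq_zero (p : ℕ) : (p : ZMod (p ^ 2)) * p = 0 := by
  rw [← pow_two, ← Nat.cast_pow, ZMod.natCast_self]

theorem mul_hmat (p : ℕ) (a b : ZMod (p ^ 2)) :
    !![1, -3; 1, -2] * hmat p a b = hmat p (-b) (a - b) * !![1, -3; 1, -2] := by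
  ext i j
  fin_cases i <;> fin_cases j <;> simp [hmat, Matrix.mul_apply, Fin.sum_univ_two] <;> ring

theorem commute_hmat (p : ℕ) (a b c d : ZMod (p ^ 2)) :
    hmat p a b * hmat p c d = hmat p c d * hmat p a b := by
  have h := natCast_mul_self_eq_zero p
  ext i j
  fin_cases i <;> fin_cases j <;> simp [hmat, Matrix.mul_apply, Fin.sum_univ_two] <;> grind

theorem commute_of_mem_H2set {p : ℕ} {x u : (Matrix (Fin 2) (Fin 2) (ZMod (p ^ 2)))ˣ}
    (hx : x ∈ H2set p) (hu : u ∈ H2set p) : Commute x u := by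
  obtain ⟨a, b, hab⟩ := hx
  obtain ⟨c, d, hcd⟩ := hu
  exact Units.ext (by simpa [hab, hcd] using commute_hmat p a b c d)

theorem conj_mem_H2set {p : ℕ} {g u : (Matrix (Fin 2) (Fin 2) (ZMod (p ^ 2)))ˣ}
    (hg : (g : Matrix (Fin 2) (Fin 2) (ZMod (p ^ 2))) = !![1, -3; 1, -2]) (hu : u ∈ H2set p) :
    g * u * g⁻¹ ∈ H2set p ∧ g⁻¹ * u * g ∈ H2set p := by
  obtain ⟨a, b, hab⟩ := hu
  refine ⟨⟨-b, a - b, ?_⟩, ⟨b - a, -a, ?_⟩⟩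
  · rw [Units.val_mul, Units.mul_inv_eq_iff_eq_mul, Units.val_mul, hab, hg, mul_hmat]
  · rw [mul_assoc, Units.val_mul, Units.inv_mul_eq_iff_eq_mul, Units.val_mul, hab, hg, mul_hmat]
    simp

/-- **(part of Lemma 3.2, following [GR18, Section 5]).**
`g·H₂·g⁻¹ = H₂`, hence `H₂` is normal in `G₂ = ⟨g, H₂⟩`. -/
theorem H2_normal_in_G2 (p : ℕ) [Fact p.Prime] (hp3 : p % 3 = 2)
    (g : (Matrix (Fin 2) (Fin 2) (ZMod (p ^ 2)))ˣ)
    (hg : (g : Matrix (Fin 2) (Fin 2) (ZMod (p ^ 2))) = !![1, -3; 1, -2]) :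
    (∀ u ∈ H2set p, g * u * g⁻¹ ∈ H2set p ∧ g⁻¹ * u * g ∈ H2set p) ∧
    (∀ x ∈ G2 p g, ∀ u ∈ H2set p, x * u * x⁻¹ ∈ H2set p) := by
  refine ⟨fun u hu => conj_mem_H2set hg hu, fun x hx => ?_⟩
  suffices h : ∀ u ∈ H2set p, x * u * x⁻¹ ∈ H2set p ∧ x⁻¹ * u * x ∈ H2set p from
    fun u hu => (h u hu).1
  induction hx using Subgroup.closure_induction with
  | mem x hx =>
    intro u hu
    rcases hx with rfl | hx
    · exact conj_mem_H2set hg hu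
    · have h := commute_of_mem_H2set hx hu
      rw [h.eq, mul_inv_cancel_right, mul_assoc, ← h.eq, inv_mul_cancel_left]
      exact ⟨hu, hu⟩
  | one => simp
  | mul x y _ _ hx hy =>
    intro u hu
    refine ⟨?_, ?_⟩
    · simpa [mul_assoc] using (hx _ (hy u hu).1).1
    · simpa [mul_assoc] using (hy _ (hx u hu).2).2
  | inv x _ hx =>
    intro u hu
    simpa using (hx u hu).symm
end

section
/- Let p be an odd prime and let a, b ∈ ℤ/p²ℤ. Set h := h(a,b) ∈ GL₂(ℤ/p²ℤ). Then the norm element satisfies 1 + h + h² + ⋯ + h^{p−1} = p·1 as 2×2 matrices over ℤ/p²ℤ, where 1 denotes the identity matrix. -/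
theorem one_add_pow_of_mul_self_eq_zero {R : Type*} [Ring R] {x : R} (hx : x * x = 0) (n : ℕ) :
    (1 + x) ^ n = 1 + (n : R) * x := by
  induction n with
  | zero => simp
  | succ n ih =>
    rw [pow_succ, ih, mul_add, mul_one, add_mul, one_mul, mul_assoc, hx, mul_zero, add_zero,
      Nat.cast_succ, add_mul, one_mul, add_assoc]

theorem sum_range_one_add_pow_of_odd {R : Type*} [Ring R] {x : R} (hx : x * x = 0) {n : ℕ}
    (hn : Odd n) (hnx : (n : R) * x = 0) :
    ∑ i ∈ Finset.range n, (1 + x) ^ i = (n : R) := by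
  obtain ⟨k, hk⟩ := hn
  have hsum : ∑ i ∈ Finset.range n, i = k * n := by
    have h := Finset.sum_range_id_mul_two n
    have hn1 : n - 1 = 2 * k := by omega
    rw [hn1] at h
    linarith
  simp_rw [one_add_pow_of_mul_self_eq_zero hx]
  rw [Finset.sum_add_distrib, ← Finset.sum_mul, ← Nat.cast_sum, hsum, Nat.cast_mul, mul_assoc,
    hnx]
  simp

/-- **(calculation from Lemma 3.2).** For `h = h(a,b)` one has
`1 + h + h² + ⋯ + h^{p−1} = p·1` as matrices over `ℤ/p²ℤ`. -/
theorem norm_element_eq_p_smul_one (p : ℕ) [Fact p.Prime] (hodd : Odd p)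
    (a b : ZMod (p ^ 2)) :
    ∑ i ∈ Finset.range p, hmat p a b ^ i
      = (p : ZMod (p ^ 2)) • (1 : Matrix (Fin 2) (Fin 2) (ZMod (p ^ 2))) := by
  set N : Matrix (Fin 2) (Fin 2) (ZMod (p ^ 2)) :=
    !![a - 2 * b, 3 * (b - a); -b, -(a - 2 * b)] with hN
  have hp : (p : ZMod (p ^ 2)) * p = 0 := by
    have h := ZMod.natCast_self (p ^ 2)
    rwa [pow_two, Nat.cast_mul, ← pow_two] at h
  have hh : hmat p a b = 1 + (p : ZMod (p ^ 2)) • N := by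
    ext i j
    fin_cases i <;> fin_cases j <;> simp [hmat, hN] <;> ring
  have hcast : ((p : ℕ) : Matrix (Fin 2) (Fin 2) (ZMod (p ^ 2)))
      = (p : ZMod (p ^ 2)) • 1 := by
    rw [Nat.cast_smul_eq_nsmul, nsmul_one]
  rw [hh, ← hcast]
  refine sum_range_one_add_pow_of_odd ?_ hodd ?_
  · rw [smul_mul_smul_comm, hp, zero_smul]
  · rw [hcast, smul_mul_smul_comm, hp, zero_smul]
end

section
/- Let p be a prime, let π : GL₂(ℤ/p³ℤ) → GL₂(ℤ/p²ℤ) be the reduction map, and let N := ker π, the subgroup of matrices congruent to the identity modulo p². Let M₃ := (ℤ/p³ℤ)² with N acting by matrix-vector multiplication. Then the subgroup of N-fixed vectors {v ∈ M₃ : h·v = v for all h ∈ N} equals {v ∈ M₃ : p²·v = 0}, which also equals p·M₃. -/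
/-- The reduction map `π : GL₂(ℤ/p³ℤ) → GL₂(ℤ/p²ℤ)` (entrywise reduction
modulo `p²`). -/
def piRed (p : ℕ) :
    (Matrix (Fin 2) (Fin 2) (ZMod (p ^ 3)))ˣ →* (Matrix (Fin 2) (Fin 2) (ZMod (p ^ 2)))ˣ :=
  Units.map
    ((ZMod.castHom (pow_dvd_pow p (by norm_num : (2:ℕ) ≤ 3)) (ZMod (p ^ 2))).mapMatrix.toMonoidHom)

/-- An element of `ℤ/nℤ` vanishing in `ℤ/mℤ` is a multiple of `m`. -/
theorem ZMod.dvd_of_castHom_eq_zero {m n : ℕ} [NeZero n] (h : m ∣ n) {x : ZMod n}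
    (hx : ZMod.castHom h (ZMod m) x = 0) : (m : ZMod n) ∣ x := by
  rw [← ZMod.natCast_zmod_val x, map_natCast, ZMod.natCast_eq_zero_iff] at hx
  rw [← ZMod.natCast_zmod_val x]
  exact Nat.cast_dvd_cast hx

/-- For `d ≠ 0`, the `d`-torsion of `ℤ/(d * m)ℤ` consists of the multiples of `m`. -/
theorem ZMod.natCast_mul_eq_zero_iff_dvd {d m n : ℕ} [NeZero n] (hd : d ≠ 0) (hn : n = d * m)
    (x : ZMod n) : (d : ZMod n) * x = 0 ↔ (m : ZMod n) ∣ x := by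
  constructor
  · intro h
    rw [← ZMod.natCast_zmod_val x] at h ⊢
    rw [← Nat.cast_mul, ZMod.natCast_eq_zero_iff] at h
    refine Nat.cast_dvd_cast (Nat.dvd_of_mul_dvd_mul_left (Nat.pos_of_ne_zero hd) ?_)
    rwa [← hn]
  · rintro ⟨y, rfl⟩
    rw [← mul_assoc, ← Nat.cast_mul, ← hn, ZMod.natCast_self, zero_mul]

/-- A unit lies in the kernel of reduction iff its entrywise reduction is the identity matrix. -/
theorem mem_ker_piRed_iff (p : ℕ) (u : (Matrix (Fin 2) (Fin 2) (ZMod (p ^ 3)))ˣ) :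
    u ∈ (piRed p).ker ↔
      ((ZMod.castHom (pow_dvd_pow p (by norm_num : (2 : ℕ) ≤ 3)) (ZMod (p ^ 2))).mapMatrix
        (u : Matrix (Fin 2) (Fin 2) (ZMod (p ^ 3)))) = 1 := by
  rw [MonoidHom.mem_ker, Units.ext_iff]
  rfl

/-- The transvection `1 + p² E_{ij}` as an invertible matrix over `ℤ/p³ℤ`. -/
def transvectionUnit (p : ℕ) (i j : Fin 2) (hij : i ≠ j) :
    (Matrix (Fin 2) (Fin 2) (ZMod (p ^ 3)))ˣ where
  val := Matrix.transvection i j ((p : ZMod (p ^ 3)) ^ 2)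
  inv := Matrix.transvection i j (-(p : ZMod (p ^ 3)) ^ 2)
  val_inv := by simp [Matrix.transvection_mul_transvection_same i j hij]
  inv_val := by simp [Matrix.transvection_mul_transvection_same i j hij]

theorem transvectionUnit_mem_ker (p : ℕ) (i j : Fin 2) (hij : i ≠ j) :
    transvectionUnit p i j hij ∈ (piRed p).ker := by
  have hp : ((p : ZMod (p ^ 2)) ^ 2) = 0 := by
    rw [← Nat.cast_pow, ZMod.natCast_self]
  rw [mem_ker_piRed_iff]
  ext a b
  simp only [transvectionUnit, Matrix.transvection, map_add, map_one, RingHom.mapMatrix_apply,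
    Matrix.add_apply, Matrix.map_apply, Matrix.single_apply]
  split_ifs <;> simp only [map_pow, map_natCast, hp, map_zero, add_zero]

/-- **(step in the proof of Lemma 3.2).** For `N = ker π`, the matrices
congruent to the identity mod `p²`, acting on `M₃ = (ℤ/p³ℤ)²`, the fixed
vectors `M₃^N` are exactly `M₃[p²] = p·M₃`. -/
theorem fixed_vectors_of_kernel (p : ℕ) [Fact p.Prime] :
    ({v : Fin 2 → ZMod (p ^ 3) |
        ∀ u : (Matrix (Fin 2) (Fin 2) (ZMod (p ^ 3)))ˣ, u ∈ (piRed p).ker →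
          (u : Matrix (Fin 2) (Fin 2) (ZMod (p ^ 3))).mulVec v = v}
      = {v : Fin 2 → ZMod (p ^ 3) | (p : ZMod (p ^ 3)) ^ 2 • v = 0}) ∧
    ({v : Fin 2 → ZMod (p ^ 3) | (p : ZMod (p ^ 3)) ^ 2 • v = 0}
      = {v : Fin 2 → ZMod (p ^ 3) |
          ∃ w : Fin 2 → ZMod (p ^ 3), v = (p : ZMod (p ^ 3)) • w}) := by
  have hp0 : p ≠ 0 := (Fact.out : p.Prime).ne_zero
  have : NeZero (p ^ 3) := ⟨pow_ne_zero 3 hp0⟩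
  refine ⟨?_, ?_⟩
  · ext v
    simp only [Set.mem_ofPred_eq]
    constructor
    · intro h
      have key (i j : Fin 2) (hij : i ≠ j) : (p : ZMod (p ^ 3)) ^ 2 * v j = 0 := by
        have := congrFun (h _ (transvectionUnit_mem_ker p i j hij)) i
        simpa [transvectionUnit, Matrix.transvection, Matrix.add_mulVec,
          Matrix.single_mulVec] using this
      ext j
      fin_cases j
      · exact key 1 0 (by decide)
      · exact key 0 1 (by decide)
    · intro h u hu
      rw [mem_ker_piRed_iff] at hu
      have hred : (ZMod.castHom (pow_dvd_pow p (by norm_num : (2 : ℕ) ≤ 3))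
          (ZMod (p ^ 2))).mapMatrix ((u : Matrix (Fin 2) (Fin 2) (ZMod (p ^ 3))) - 1) = 0 := by
        rw [map_sub, hu, map_one, sub_self]
      have hsub : ((u : Matrix (Fin 2) (Fin 2) (ZMod (p ^ 3))) - 1).mulVec v = 0 := by
        ext i
        rw [Matrix.mulVec, dotProduct, Pi.zero_apply]
        refine Finset.sum_eq_zero fun j _ => ?_
        have hij : ((p ^ 2 : ℕ) : ZMod (p ^ 3)) ∣
            ((u : Matrix (Fin 2) (Fin 2) (ZMod (p ^ 3))) - 1) i j :=
          ZMod.dvd_of_castHom_eq_zero (pow_dvd_pow p (by norm_num)) (congrFun₂ hred i j)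
        obtain ⟨y, hy⟩ := hij
        have hv : (p : ZMod (p ^ 3)) ^ 2 * v j = 0 := congrFun h j
        rw [hy, Nat.cast_pow, mul_right_comm, hv, zero_mul]
      rwa [Matrix.sub_mulVec, Matrix.one_mulVec, sub_eq_zero] at hsub
  · ext v
    have key (x : ZMod (p ^ 3)) : (p : ZMod (p ^ 3)) ^ 2 * x = 0 ↔ (p : ZMod (p ^ 3)) ∣ x := by
      rw [← Nat.cast_pow]
      exact ZMod.natCast_mul_eq_zero_iff_dvd (pow_ne_zero 2 hp0) (pow_succ p 2) x
    simp only [Set.mem_ofPred_eq, funext_iff, Pi.smul_apply, smul_eq_mul, Pi.zero_apply, key]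
    exact Classical.skolem
end

section
/- Let p be an odd prime with p ≡ 2 (mod 3). Let γ be any element of G₂, let Γ be the cyclic subgroup of GL₂(ℤ/p²ℤ) generated by γ, and let M₂ := (ℤ/p²ℤ)² with Γ acting by matrix-vector multiplication. Then H¹(Γ, M₂) = 0; concretely, for every 1-cocycle Z : Γ → M₂ (i.e., Z(στ) = Z(σ) + σ·Z(τ) for all σ, τ ∈ Γ) there exists m ∈ M₂ such that Z(σ) = σ·m − m for all σ ∈ Γ. -/
section CyclicCocycle

variable {R : Type*} [CommRing R] {ι : Type*} [Fintype ι] [DecidableEq ι]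

/-- The value of a 1-cocycle at a power of the generator. -/
theorem cocycle_pow_eq_geom_sum (γ : (Matrix ι ι R)ˣ) (Z : Subgroup.zpowers γ → (ι → R))
    (hcoc : ∀ σ τ : Subgroup.zpowers γ,
      Z (σ * τ) = Z σ + ((σ : (Matrix ι ι R)ˣ) : Matrix ι ι R).mulVec (Z τ)) (n : ℕ) :
    Z (⟨γ, Subgroup.mem_zpowers γ⟩ ^ n) =
      (∑ i ∈ Finset.range n, (γ : Matrix ι ι R) ^ i).mulVec (Z ⟨γ, Subgroup.mem_zpowers γ⟩) := by
  induction n with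
  | zero =>
    have h := hcoc 1 1
    simpa using h
  | succ n ih =>
    rw [pow_succ', hcoc, ih, geom_sum_succ, Matrix.add_mulVec, Matrix.mulVec_mulVec,
      Matrix.one_mulVec, add_comm]

/-- A 1-cocycle on a finite cyclic matrix group that is a coboundary at the generator is a
coboundary. -/
theorem cocycle_eq_coboundary_of_generator [Finite R] (γ : (Matrix ι ι R)ˣ)
    (Z : Subgroup.zpowers γ → (ι → R))
    (hcoc : ∀ σ τ : Subgroup.zpowers γ,
      Z (σ * τ) = Z σ + ((σ : (Matrix ι ι R)ˣ) : Matrix ι ι R).mulVec (Z τ))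
    (m : ι → R)
    (hm : Z ⟨γ, Subgroup.mem_zpowers γ⟩ = ((γ : Matrix ι ι R) - 1).mulVec m)
    (σ : Subgroup.zpowers γ) :
    Z σ = ((σ : (Matrix ι ι R)ˣ) : Matrix ι ι R).mulVec m - m := by
  have : Finite (Matrix ι ι R) := inferInstanceAs (Finite (ι → ι → R))
  obtain ⟨σ, hσ⟩ := σ
  obtain ⟨n, rfl⟩ := (mem_powers_iff_mem_zpowers (x := γ)).mpr hσ
  have h := cocycle_pow_eq_geom_sum γ Z hcoc n
  rw [hm, Matrix.mulVec_mulVec, geom_sum_mul, Matrix.sub_mulVec, Matrix.one_mulVec] at h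
  simpa using h

end CyclicCocycle

theorem one_add_pow_of_sq_eq_zero {A : Type*} [Ring A] {x : A} (hx : x * x = 0) (n : ℕ) :
    (1 + x) ^ n = 1 + n * x := by
  induction n with
  | zero => simp
  | succ n ih =>
    rw [pow_succ, ih, add_mul, mul_add, mul_add, mul_assoc (n : A) x x, hx]
    push_cast
    noncomm_ring

/-- If `p` is odd, `x ^ 2 = 0` and `p x = 0`, then `1 + (1 + x) + ⋯ + (1 + x) ^ (p - 1) = p`. -/
theorem geom_sum_one_add_of_sq_eq_zero {A : Type*} [Ring A] {x : A} (hx : x * x = 0) {p : ℕ}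
    (hodd : Odd p) (hpx : (p : A) * x = 0) :
    ∑ i ∈ Finset.range p, (1 + x) ^ i = (p : A) := by
  obtain ⟨k, rfl⟩ := hodd
  have hs : ∑ i ∈ Finset.range (2 * k + 1), i = k * (2 * k + 1) := by
    rw [Finset.sum_range_id, Nat.add_sub_cancel]
    exact Nat.div_eq_of_eq_mul_left two_pos (by ring)
  simp_rw [one_add_pow_of_sq_eq_zero hx]
  rw [Finset.sum_add_distrib, ← Finset.sum_mul, ← Nat.cast_sum, hs, Nat.cast_mul, mul_assoc, hpx]
  simp

theorem ZMod.three_ne_zero_of_mod_three {p : ℕ} [Fact p.Prime] (hp3 : p % 3 = 2) :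
    (3 : ZMod p) ≠ 0 := by
  intro h0
  have hd : p ∣ 3 := (ZMod.natCast_eq_zero_iff 3 p).mp (by exact_mod_cast h0)
  have := (Nat.prime_dvd_prime_iff_eq Fact.out Nat.prime_three).mp hd
  omega

/-- The norm form `x ^ 2 - x y + y ^ 2` is anisotropic modulo a prime `p ≡ 2 mod 3`. -/
theorem eq_zero_of_sq_sub_mul_add_sq_eq_zero {p : ℕ} [Fact p.Prime] (hp3 : p % 3 = 2)
    {x y : ZMod p} (h : x ^ 2 - x * y + y ^ 2 = 0) : x = 0 ∧ y = 0 := by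
  obtain ⟨k, hk⟩ : ∃ k, p = 3 * k + 2 := ⟨p / 3, by omega⟩
  have hcube (t : ZMod p) : (t ^ 3) ^ (2 * k + 1) = t := by
    have ht : t ^ (3 * k + 2) = t := hk ▸ ZMod.pow_card t
    calc (t ^ 3) ^ (2 * k + 1) = t ^ (3 * k + 2) * t ^ (3 * k + 1) := by ring
      _ = t * t ^ (3 * k + 1) := by rw [ht]
      _ = t ^ (3 * k + 2) := by ring
      _ = t := ht
  have hxy : x = -y := by
    rw [← hcube x, ← hcube (-y)]
    congr 1
    linear_combination (x + y) * h
  have h3 := ZMod.three_ne_zero_of_mod_three hp3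
  have hy : y = 0 := by
    subst hxy
    have : 3 * y ^ 2 = 0 := by linear_combination h
    simpa [h3] using this
  exact ⟨by rw [hxy, hy, neg_zero], hy⟩

section ZModSq

variable {p : ℕ}

theorem ZMod.natCast_mul_self_sq_eq_zero : (p : ZMod (p ^ 2)) * p = 0 := by
  have := ZMod.natCast_self (p ^ 2)
  push_cast at this
  rw [← sq, this]

/-- Reduction modulo `p` from `ℤ/p²ℤ`. -/
def ZMod.redSq (p : ℕ) : ZMod (p ^ 2) →+* ZMod p :=
  ZMod.castHom (dvd_pow_self p two_ne_zero) (ZMod p)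

theorem ZMod.exists_eq_mul_of_redSq_eq_zero [Fact p.Prime] {x : ZMod (p ^ 2)}
    (h : ZMod.redSq p x = 0) : ∃ y : ZMod (p ^ 2), x = (p : ZMod (p ^ 2)) * y := by
  have : NeZero (p ^ 2) := ⟨pow_ne_zero 2 (Fact.out : p.Prime).ne_zero⟩
  rw [← ZMod.natCast_zmod_val x, map_natCast, ZMod.natCast_eq_zero_iff] at h
  obtain ⟨c, hc⟩ := h
  exact ⟨c, by rw [← ZMod.natCast_zmod_val x, hc, Nat.cast_mul]⟩

theorem ZMod.exists_eq_mul_of_mul_eq_zero [Fact p.Prime] {x : ZMod (p ^ 2)}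
    (h : (p : ZMod (p ^ 2)) * x = 0) : ∃ y : ZMod (p ^ 2), x = (p : ZMod (p ^ 2)) * y := by
  have hp : 0 < p := (Fact.out : p.Prime).pos
  have : NeZero (p ^ 2) := ⟨pow_ne_zero 2 hp.ne'⟩
  rw [← ZMod.natCast_zmod_val x, ← Nat.cast_mul, ZMod.natCast_eq_zero_iff] at h
  obtain ⟨c, hc⟩ := Nat.dvd_of_mul_dvd_mul_left hp ((dvd_of_eq (sq p).symm).trans h)
  exact ⟨c, by rw [← ZMod.natCast_zmod_val x, hc, Nat.cast_mul]⟩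

theorem ZMod.isUnit_of_redSq_ne_zero [Fact p.Prime] {x : ZMod (p ^ 2)}
    (h : ZMod.redSq p x ≠ 0) : IsUnit x := by
  obtain ⟨y, hy⟩ := ZMod.ringHom_surjective (ZMod.redSq p) (ZMod.redSq p x)⁻¹
  obtain ⟨z, hz⟩ : ∃ z : ZMod (p ^ 2), x * y - 1 = (p : ZMod (p ^ 2)) * z := ZMod.exists_eq_mul_of_redSq_eq_zero (by
    rw [map_sub, map_mul, hy, map_one, mul_inv_cancel₀ h, sub_self])
  refine IsUnit.of_mul_eq_one (y * (1 - p * z)) ?_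
  linear_combination (1 - p * z) * hz - z ^ 2 * ZMod.natCast_mul_self_sq_eq_zero (p := p)

theorem ZMod.isUnit_three_of_mod_three [Fact p.Prime] (hp3 : p % 3 = 2) :
    IsUnit (3 : ZMod (p ^ 2)) :=
  ZMod.isUnit_of_redSq_ne_zero (by
    rw [map_ofNat]
    exact ZMod.three_ne_zero_of_mod_three hp3)

end ZModSq

theorem hmat_mul_hmat (p : ℕ) (a b c d : ZMod (p ^ 2)) :
    hmat p a b * hmat p c d = hmat p (a + c) (b + d) := by
  have hp := ZMod.natCast_mul_self_sq_eq_zero (p := p)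
  ext i j
  fin_cases i <;> fin_cases j <;> simp [hmat, Matrix.mul_apply, Fin.sum_univ_two]
  · linear_combination ((a - 2 * b) * (c - 2 * d) - 3 * (b - a) * d) * hp
  · linear_combination (3 * (a - 2 * b) * (d - c) - 3 * (b - a) * (c - 2 * d)) * hp
  · linear_combination (-b * (c - 2 * d) + (a - 2 * b) * d) * hp
  · linear_combination (-3 * b * (d - c) + (a - 2 * b) * (c - 2 * d)) * hp

theorem hmat_zero (p : ℕ) : hmat p 0 0 = 1 := by
  ext i j
  fin_cases i <;> fin_cases j <;> simp [hmat]

theorem hmat_mul_generator (p : ℕ) (a b : ZMod (p ^ 2)) :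
    hmat p a b * !![1, -3; 1, -2] = !![1, -3; 1, -2] * hmat p (b - a) (-a) := by
  ext i j
  fin_cases i <;> fin_cases j <;> simp [hmat, Matrix.mul_apply, Fin.sum_univ_two] <;> ring

theorem generator_pow_three (p : ℕ) :
    (!![1, -3; 1, -2] : Matrix (Fin 2) (Fin 2) (ZMod (p ^ 2))) ^ 3 = 1 := by
  ext i j
  fin_cases i <;> fin_cases j <;> simp [pow_succ, Matrix.mul_apply, Fin.sum_univ_two] <;> ring

/-- Every element of `G₂` is of the form `gⁱ h` with `h ∈ H₂` and `i < 3`. -/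
theorem exists_eq_pow_mul_hmat_of_mem_G2 {p : ℕ}
    {g : (Matrix (Fin 2) (Fin 2) (ZMod (p ^ 2)))ˣ}
    (hg : (g : Matrix (Fin 2) (Fin 2) (ZMod (p ^ 2))) = !![1, -3; 1, -2])
    {γ : (Matrix (Fin 2) (Fin 2) (ZMod (p ^ 2)))ˣ} (hγ : γ ∈ G2 p g) :
    ∃ i < 3, ∃ a b : ZMod (p ^ 2),
      (γ : Matrix (Fin 2) (Fin 2) (ZMod (p ^ 2))) = !![1, -3; 1, -2] ^ i * hmat p a b := by
  suffices ∃ i : ℕ, ∃ a b : ZMod (p ^ 2),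
      (γ : Matrix (Fin 2) (Fin 2) (ZMod (p ^ 2))) = !![1, -3; 1, -2] ^ i * hmat p a b by
    obtain ⟨i, a, b, h⟩ := this
    refine ⟨i % 3, Nat.mod_lt _ (by norm_num), a, b, ?_⟩
    rw [h, pow_eq_pow_mod i (generator_pow_three p)]
  have hg3 : g ^ 3 = 1 := Units.ext (by rw [Units.val_pow_eq_pow_val, hg, generator_pow_three]; rfl)
  have hginv : g⁻¹ = g * g := by
    rw [inv_eq_iff_mul_eq_one, ← hg3, pow_three]
  have key (x : (Matrix (Fin 2) (Fin 2) (ZMod (p ^ 2)))ˣ) (hx : ∃ i : ℕ, ∃ a b : ZMod (p ^ 2),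
      (x : Matrix (Fin 2) (Fin 2) (ZMod (p ^ 2))) = !![1, -3; 1, -2] ^ i * hmat p a b) :
      ∃ i : ℕ, ∃ a b : ZMod (p ^ 2),
        ((x * g : (Matrix (Fin 2) (Fin 2) (ZMod (p ^ 2)))ˣ) :
          Matrix (Fin 2) (Fin 2) (ZMod (p ^ 2))) = !![1, -3; 1, -2] ^ i * hmat p a b := by
    obtain ⟨i, a, b, h⟩ := hx
    refine ⟨i + 1, b - a, -a, ?_⟩
    rw [Units.val_mul, h, hg, mul_assoc, hmat_mul_generator, ← mul_assoc, ← pow_succ]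
  induction hγ using Subgroup.closure_induction_right with
  | one => exact ⟨0, 0, 0, by simp [hmat_zero]⟩
  | mul_right x _ y hy ih =>
    rcases hy with rfl | ⟨c, d, hy⟩
    · exact key x ih
    · obtain ⟨i, a, b, h⟩ := ih
      exact ⟨i, a + c, b + d, by rw [Units.val_mul, h, hy, mul_assoc, hmat_mul_hmat]⟩
  | mul_inv_cancel x _ y hy ih =>
    rcases hy with rfl | ⟨c, d, hy⟩
    · rw [hginv, ← mul_assoc]
      exact key _ (key x ih)
    · obtain ⟨i, a, b, h⟩ := ih
      have hyinv : ((y⁻¹ : (Matrix (Fin 2) (Fin 2) (ZMod (p ^ 2)))ˣ) :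
          Matrix (Fin 2) (Fin 2) (ZMod (p ^ 2))) = hmat p (-c) (-d) :=
        Units.inv_eq_of_mul_eq_one_right (by rw [hy, hmat_mul_hmat]; simp [hmat_zero])
      exact ⟨i, a + -c, b + -d, by rw [Units.val_mul, h, hyinv, mul_assoc, hmat_mul_hmat]⟩

theorem isUnit_det_generator_mul_hmat_sub_one {p : ℕ} [Fact p.Prime] (hp3 : p % 3 = 2)
    (a b : ZMod (p ^ 2)) : IsUnit (!![1, -3; 1, -2] * hmat p a b - 1).det := by
  have hp := ZMod.natCast_mul_self_sq_eq_zero (p := p)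
  convert ZMod.isUnit_three_of_mod_three hp3 using 1
  rw [Matrix.det_fin_two]
  simp [hmat]
  linear_combination (-a ^ 2 + a * b - b ^ 2) * hp

theorem isUnit_det_generator_sq_mul_hmat_sub_one {p : ℕ} [Fact p.Prime] (hp3 : p % 3 = 2)
    (a b : ZMod (p ^ 2)) : IsUnit (!![1, -3; 1, -2] ^ 2 * hmat p a b - 1).det := by
  have hp := ZMod.natCast_mul_self_sq_eq_zero (p := p)
  convert ZMod.isUnit_three_of_mod_three hp3 using 1
  rw [Matrix.det_fin_two]
  simp [hmat, sq]
  linear_combination (-a ^ 2 + a * b - b ^ 2) * hp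

/-- A vector killed by `p` lies in the image of `h(a,b) - 1`, unless
`h(a,b) = 1`. -/
theorem hmat_eq_one_or_exists_eq_mulVec {p : ℕ} [Fact p.Prime] (hp3 : p % 3 = 2)
    (a b : ZMod (p ^ 2)) :
    hmat p a b = 1 ∨ ∀ v : Fin 2 → ZMod (p ^ 2), (p : ZMod (p ^ 2)) • v = 0 →
      ∃ m, v = (hmat p a b - 1).mulVec m := by
  have hp := ZMod.natCast_mul_self_sq_eq_zero (p := p)
  by_cases hq : ZMod.redSq p (a ^ 2 - a * b + b ^ 2) = 0
  · left
    simp only [map_add, map_sub, map_mul, map_pow] at hq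
    obtain ⟨ha, hb⟩ := eq_zero_of_sq_sub_mul_add_sq_eq_zero hp3 hq
    obtain ⟨a', rfl⟩ := ZMod.exists_eq_mul_of_redSq_eq_zero ha
    obtain ⟨b', rfl⟩ := ZMod.exists_eq_mul_of_redSq_eq_zero hb
    ext i j
    fin_cases i <;> fin_cases j <;> simp [hmat]
    · linear_combination (a' - 2 * b') * hp
    · linear_combination 3 * (b' - a') * hp
    · linear_combination b' * hp
    · linear_combination (a' - 2 * b') * hp
  · right
    intro v hv
    obtain ⟨r, hr⟩ := (ZMod.isUnit_of_redSq_ne_zero hq).exists_right_inv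
    obtain ⟨x, hx⟩ := ZMod.exists_eq_mul_of_mul_eq_zero (congrFun hv 0)
    obtain ⟨y, hy⟩ := ZMod.exists_eq_mul_of_mul_eq_zero (congrFun hv 1)
    refine ⟨![r * ((a - 2 * b) * x + 3 * (b - a) * y), r * (-b * x - (a - 2 * b) * y)], ?_⟩
    ext i
    fin_cases i <;> simp [hmat, Matrix.mulVec, dotProduct, Fin.sum_univ_two]
    · linear_combination hx - p * x * hr
    · linear_combination hy - p * y * hr

/-- **(claim in the proof of Lemma 3.2).** For every `γ ∈ G₂`, with `Γ = ⟨γ⟩`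
the cyclic subgroup generated by `γ` acting on `M₂ = (ℤ/p²ℤ)²`, one has
`H¹(Γ, M₂) = 0`: every 1-cocycle `Z : Γ → M₂` is a coboundary. -/
theorem H1_cyclic_subgroup_of_G2_vanishes (p : ℕ) [Fact p.Prime] (hodd : Odd p)
    (hp3 : p % 3 = 2)
    (g : (Matrix (Fin 2) (Fin 2) (ZMod (p ^ 2)))ˣ)
    (hg : (g : Matrix (Fin 2) (Fin 2) (ZMod (p ^ 2))) = !![1, -3; 1, -2])
    (γ : (Matrix (Fin 2) (Fin 2) (ZMod (p ^ 2)))ˣ) (hγ : γ ∈ G2 p g)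
    (Z : Subgroup.zpowers γ → (Fin 2 → ZMod (p ^ 2)))
    (hcoc : ∀ σ τ : Subgroup.zpowers γ,
      Z (σ * τ) = Z σ +
        ((σ : (Matrix (Fin 2) (Fin 2) (ZMod (p ^ 2)))ˣ) :
          Matrix (Fin 2) (Fin 2) (ZMod (p ^ 2))).mulVec (Z τ)) :
    ∃ m : Fin 2 → ZMod (p ^ 2), ∀ σ : Subgroup.zpowers γ,
      Z σ = ((σ : (Matrix (Fin 2) (Fin 2) (ZMod (p ^ 2)))ˣ) :
          Matrix (Fin 2) (Fin 2) (ZMod (p ^ 2))).mulVec m - m := by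
  obtain ⟨i, hi, a, b, hγ'⟩ := exists_eq_pow_mul_hmat_of_mem_G2 hg hγ
  have : NeZero (p ^ 2) := ⟨pow_ne_zero 2 (Fact.out : p.Prime).ne_zero⟩
  suffices ∃ m, Z ⟨γ, Subgroup.mem_zpowers γ⟩ =
      ((γ : Matrix (Fin 2) (Fin 2) (ZMod (p ^ 2))) - 1).mulVec m by
    obtain ⟨m, hm⟩ := this
    exact ⟨m, cocycle_eq_coboundary_of_generator γ Z hcoc m hm⟩
  have of_isUnit
      (hu : IsUnit ((γ : Matrix (Fin 2) (Fin 2) (ZMod (p ^ 2))) - 1).det) :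
      ∃ m, Z ⟨γ, Subgroup.mem_zpowers γ⟩ =
        ((γ : Matrix (Fin 2) (Fin 2) (ZMod (p ^ 2))) - 1).mulVec m := by
    refine ⟨((γ : Matrix (Fin 2) (Fin 2) (ZMod (p ^ 2))) - 1)⁻¹.mulVec
      (Z ⟨γ, Subgroup.mem_zpowers γ⟩), ?_⟩
    rw [Matrix.mulVec_mulVec, Matrix.mul_nonsing_inv _ hu, Matrix.one_mulVec]
  interval_cases i
  · rw [pow_zero, one_mul] at hγ'
    have hZ1 : Z 1 = 0 := by simpa using hcoc 1 1
    rcases hmat_eq_one_or_exists_eq_mulVec hp3 a b with h1 | himage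
    · obtain rfl : γ = 1 := Units.ext (hγ'.trans h1)
      exact ⟨0, by rw [Matrix.mulVec_zero]; exact hZ1⟩
    · rw [hγ']
      apply himage
      have hp := ZMod.natCast_mul_self_sq_eq_zero (p := p)
      obtain ⟨X, hX, hXX, hpX⟩ : ∃ X, hmat p a b = 1 + X ∧ X * X = 0 ∧
          (p : Matrix (Fin 2) (Fin 2) (ZMod (p ^ 2))) * X = 0 := by
        let N : Matrix (Fin 2) (Fin 2) (ZMod (p ^ 2)) :=
          !![a - 2 * b, 3 * (b - a); -b, -(a - 2 * b)]
        refine ⟨(p : ZMod (p ^ 2)) • N, ?_, ?_, ?_⟩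
        · ext i j
          fin_cases i <;> fin_cases j <;> simp [hmat, N] <;> ring
        · rw [smul_mul_smul_comm, hp, zero_smul]
        · rw [← nsmul_eq_mul, ← Nat.cast_smul_eq_nsmul (ZMod (p ^ 2)), smul_smul, hp, zero_smul]
      have hpow : (⟨γ, Subgroup.mem_zpowers γ⟩ : Subgroup.zpowers γ) ^ p = 1 := by
        refine Subtype.ext (Units.ext ?_)
        simp [hγ', hX, one_add_pow_of_sq_eq_zero hXX, hpX]
      have hsum := cocycle_pow_eq_geom_sum γ Z hcoc p
      rw [hpow, hZ1, hγ', hX, geom_sum_one_add_of_sq_eq_zero hXX hodd hpX] at hsum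
      rw [hsum, Matrix.natCast_mulVec]
  · exact of_isUnit (by
      rw [hγ', pow_one]
      exact isUnit_det_generator_mul_hmat_sub_one hp3 a b)
  · exact of_isUnit (by
      rw [hγ']
      exact isUnit_det_generator_sq_mul_hmat_sub_one hp3 a b)
end

section
/- Let p be an odd prime with p ≡ 2 (mod 3). Let π : GL₂(ℤ/p³ℤ) → GL₂(ℤ/p²ℤ) be the reduction map and G₃ := π⁻¹(G₂). Let M₃ := (ℤ/p³ℤ)² and let Z : G₃ → M₃ be a 1-cocycle (Z(στ) = Z(σ) + σ·Z(τ)) such that for every σ ∈ G₃ there exists m ∈ M₃ (depending on σ) with Z(σ) = σ·m − m. Then the class of Z is inflated from G₂: there exist m₀ ∈ M₃ and a map W : G₂ → M₃ taking values in {v ∈ M₃ : p²·v = 0} such that Z(σ) = W(π(σ)) + σ·m₀ − m₀ for all σ ∈ G₃ (in particular W ∘ π is a 1-cocycle on G₃, trivial on the kernel N of π restricted to G₃). -/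
/-- `G₃ := π⁻¹(G₂)`. -/
def G3 (p : ℕ) (g : (Matrix (Fin 2) (Fin 2) (ZMod (p ^ 2)))ˣ) :
    Subgroup ((Matrix (Fin 2) (Fin 2) (ZMod (p ^ 3)))ˣ) :=
  (G2 p g).comap (piRed p)

open Matrix

/-- An additive map on `2 × 2` matrices over `ℤ/nℤ` with `f A ∈ q • im A` for all `A` is
`A ↦ q • A v` for a single vector `v`. -/
lemma exists_forall_eq_smul_mulVec {n : ℕ} (q : ZMod n)
    (f : Matrix (Fin 2) (Fin 2) (ZMod n) →+ (Fin 2 → ZMod n))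
    (hf : ∀ A, ∃ v, f A = q • A *ᵥ v) : ∃ v, ∀ A, f A = q • A *ᵥ v := by
  obtain ⟨a, ha⟩ := hf !![1, 0; 0, 0]
  obtain ⟨b, hb⟩ := hf !![0, 1; 0, 0]
  obtain ⟨c, hc⟩ := hf !![0, 0; 1, 0]
  obtain ⟨d, hd⟩ := hf !![0, 0; 0, 1]
  obtain ⟨e, he⟩ := hf (!![1, 0; 0, 0] + !![0, 0; 1, 0])
  obtain ⟨k, hk⟩ := hf (!![0, 1; 0, 0] + !![0, 0; 0, 1])
  rw [map_add, ha, hc] at he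
  rw [map_add, hb, hd] at hk
  have hac : q * a 0 = q * c 0 := by
    have h0 := congrFun he 0
    have h1 := congrFun he 1
    simp [dotProduct] at h0 h1
    rw [h0, h1]
  have hbd : q * b 1 = q * d 1 := by
    have h0 := congrFun hk 0
    have h1 := congrFun hk 1
    simp [dotProduct] at h0 h1
    rw [h0, h1]
  refine ⟨![a 0, b 1], fun A ↦ ?_⟩
  have hA : A = A 0 0 • !![1, 0; 0, 0] + A 0 1 • !![0, 1; 0, 0] + A 1 0 • !![0, 0; 1, 0] +
      A 1 1 • !![0, 0; 0, 1] := by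
    ext i j
    fin_cases i <;> fin_cases j <;> simp
  conv_lhs => rw [hA]
  simp only [map_add, ZMod.map_smul, ha, hb, hc, hd]
  ext i
  fin_cases i
  · simp [dotProduct]
    ring
  · simp [dotProduct]
    linear_combination -A 1 0 * hac - A 1 1 * hbd

/-- The unit `1 + q A`, for `q` of square zero. -/
def oneAddSmulUnit {R : Type*} [CommRing R] (q : R) (hq : q * q = 0)
    (A : Matrix (Fin 2) (Fin 2) R) : (Matrix (Fin 2) (Fin 2) R)ˣ where
  val := 1 + q • A
  inv := 1 - q • A
  val_inv := by simp [mul_sub, add_mul, smul_smul, hq]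
  inv_val := by simp [mul_add, sub_mul, smul_sub, smul_smul, hq]

lemma oneAddSmulUnit_add {R : Type*} [CommRing R] (q : R) (hq : q * q = 0)
    (A B : Matrix (Fin 2) (Fin 2) R) :
    oneAddSmulUnit q hq (A + B) = oneAddSmulUnit q hq A * oneAddSmulUnit q hq B := by
  ext1
  simp [oneAddSmulUnit, mul_add, add_mul, smul_smul, hq]
  abel

lemma primePow_sq_mul_sq (p : ℕ) : (p : ZMod (p ^ 3)) ^ 2 * (p : ZMod (p ^ 3)) ^ 2 = 0 := by
  have h : ((p ^ 3 : ℕ) : ZMod (p ^ 3)) = 0 := ZMod.natCast_self _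
  push_cast at h
  linear_combination (p : ZMod (p ^ 3)) * h

lemma piRed_oneAddSmulUnit (p : ℕ) (A : Matrix (Fin 2) (Fin 2) (ZMod (p ^ 3))) :
    piRed p (oneAddSmulUnit ((p : ZMod (p ^ 3)) ^ 2) (primePow_sq_mul_sq p) A) = 1 := by
  have h : ((p ^ 2 : ℕ) : ZMod (p ^ 2)) = 0 := ZMod.natCast_self _
  push_cast at h
  ext i j
  by_cases hij : i = j <;> simp [piRed, oneAddSmulUnit, -ZMod.castHom_apply, h, hij]

lemma exists_eq_oneAddSmulUnit (p : ℕ) [NeZero p] (σ : (Matrix (Fin 2) (Fin 2) (ZMod (p ^ 3)))ˣ)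
    (hσ : piRed p σ = 1) :
    ∃ A, σ = oneAddSmulUnit ((p : ZMod (p ^ 3)) ^ 2) (primePow_sq_mul_sq p) A := by
  have key : ∀ i j, ∃ a, (σ : Matrix (Fin 2) (Fin 2) (ZMod (p ^ 3))) i j - (1 : Matrix (Fin 2) (Fin 2) (ZMod (p ^ 3))) i j =
      (p : ZMod (p ^ 3)) ^ 2 * a := by
    intro i j
    have h := congrArg (fun u : (Matrix (Fin 2) (Fin 2) (ZMod (p ^ 2)))ˣ ↦
      (u : Matrix (Fin 2) (Fin 2) (ZMod (p ^ 2))) i j) hσ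
    have h0 : ZMod.castHom (pow_dvd_pow p (by norm_num : (2 : ℕ) ≤ 3)) (ZMod (p ^ 2))
        ((σ : Matrix (Fin 2) (Fin 2) (ZMod (p ^ 3))) i j - (1 : Matrix (Fin 2) (Fin 2) (ZMod (p ^ 3))) i j) = 0 := by
      rw [map_sub, sub_eq_zero]
      simp only [piRed, Units.coe_map] at h
      refine Eq.trans h ?_
      by_cases hij : i = j <;> simp [Matrix.one_apply, hij, -ZMod.castHom_apply]
    generalize (σ : Matrix (Fin 2) (Fin 2) (ZMod (p ^ 3))) i j - (1 : Matrix (Fin 2) (Fin 2) (ZMod (p ^ 3))) i j = x at h0 ⊢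
    rw [← ZMod.natCast_zmod_val x, map_natCast, ZMod.natCast_eq_zero_iff] at h0
    obtain ⟨k, hk⟩ := h0
    refine ⟨k, ?_⟩
    rw [← ZMod.natCast_zmod_val x, hk]
    push_cast
    rfl
  choose A hA using key
  refine ⟨Matrix.of A, ?_⟩
  ext i j
  simp [oneAddSmulUnit, ← hA]

/-- **(inflation step in the proof of Lemma 3.2).** Any 1-cocycle
`Z : G₃ → M₃` whose class lies in `H¹_cyc(G₃, M₃)` (each `Z(σ)` is a
coboundary value) is, up to a coboundary, inflated from a map
`W : G₂ → M₃[p²]`: there are `m₀ ∈ M₃` and `W` with values killed by `p²`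
such that `Z(σ) = W(π(σ)) + σ·m₀ − m₀` for all `σ ∈ G₃`. -/
theorem cocycle_on_G3_is_inflated (p : ℕ) [Fact p.Prime] (hodd : Odd p)
    (hp3 : p % 3 = 2)
    (g : (Matrix (Fin 2) (Fin 2) (ZMod (p ^ 2)))ˣ)
    (hg : (g : Matrix (Fin 2) (Fin 2) (ZMod (p ^ 2))) = !![1, -3; 1, -2])
    (Z : G3 p g → (Fin 2 → ZMod (p ^ 3)))
    (hcoc : ∀ σ τ : G3 p g,
      Z (σ * τ) = Z σ +
        ((σ : (Matrix (Fin 2) (Fin 2) (ZMod (p ^ 3)))ˣ) :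
          Matrix (Fin 2) (Fin 2) (ZMod (p ^ 3))).mulVec (Z τ))
    (hloc : ∀ σ : G3 p g, ∃ m : Fin 2 → ZMod (p ^ 3),
      Z σ = ((σ : (Matrix (Fin 2) (Fin 2) (ZMod (p ^ 3)))ˣ) :
          Matrix (Fin 2) (Fin 2) (ZMod (p ^ 3))).mulVec m - m) :
    ∃ (m₀ : Fin 2 → ZMod (p ^ 3))
      (W : (Matrix (Fin 2) (Fin 2) (ZMod (p ^ 2)))ˣ → (Fin 2 → ZMod (p ^ 3))),
      (∀ x, (p : ZMod (p ^ 3)) ^ 2 • W x = 0) ∧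
      ∀ σ : G3 p g,
        Z σ = W (piRed p σ) +
          (((σ : (Matrix (Fin 2) (Fin 2) (ZMod (p ^ 3)))ˣ) :
            Matrix (Fin 2) (Fin 2) (ZMod (p ^ 3))).mulVec m₀ - m₀) := by
  classical
  have : NeZero p := ⟨(Fact.out : p.Prime).ne_zero⟩
  set q : ZMod (p ^ 3) := (p : ZMod (p ^ 3)) ^ 2 with hq
  have hqq : q * q = 0 := primePow_sq_mul_sq p
  let ν : Matrix (Fin 2) (Fin 2) (ZMod (p ^ 3)) → G3 p g := fun A ↦
    ⟨oneAddSmulUnit q hqq A, by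
      rw [G3, Subgroup.mem_comap, piRed_oneAddSmulUnit]
      exact one_mem _⟩
  have hν (A v) : ((ν A : (Matrix (Fin 2) (Fin 2) (ZMod (p ^ 3)))ˣ) :
      Matrix (Fin 2) (Fin 2) (ZMod (p ^ 3))) *ᵥ v = v + q • A *ᵥ v := by
    simp [ν, oneAddSmulUnit, add_mulVec, smul_mulVec]
  have hZν (A) : ∃ v, Z (ν A) = q • A *ᵥ v := by
    obtain ⟨m, hm⟩ := hloc (ν A)
    exact ⟨m, by rw [hm, hν, add_sub_cancel_left]⟩
  have hadd (A B) : Z (ν (A + B)) = Z (ν A) + Z (ν B) := by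
    have h : ν (A + B) = ν A * ν B := Subtype.ext (oneAddSmulUnit_add q hqq A B)
    obtain ⟨v, hv⟩ := hZν B
    rw [h, hcoc, hν, hv, mulVec_smul, smul_smul, hqq, zero_smul, add_zero]
  obtain ⟨m₀, hm₀⟩ := exists_forall_eq_smul_mulVec q (AddMonoidHom.mk' _ hadd) hZν
  let Y : G3 p g → (Fin 2 → ZMod (p ^ 3)) := fun σ ↦ Z σ -
    (((σ : (Matrix (Fin 2) (Fin 2) (ZMod (p ^ 3)))ˣ) :
      Matrix (Fin 2) (Fin 2) (ZMod (p ^ 3))) *ᵥ m₀ - m₀)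
  have hY (σ τ) : Y (σ * τ) = Y σ + ((σ : (Matrix (Fin 2) (Fin 2) (ZMod (p ^ 3)))ˣ) :
      Matrix (Fin 2) (Fin 2) (ZMod (p ^ 3))) *ᵥ Y τ := by
    simp only [Y, hcoc, Subgroup.coe_mul, Units.val_mul, mulVec_sub, mulVec_mulVec]
    abel
  have hYν (A) : Y (ν A) = 0 := by
    have h : Z (ν A) = q • A *ᵥ m₀ := hm₀ A
    simp only [Y, h, hν, add_sub_cancel_left, sub_self]
  have hYker (σ : G3 p g) (hσ : piRed p σ = 1) : Y σ = 0 := by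
    obtain ⟨A, hA⟩ := exists_eq_oneAddSmulUnit p σ hσ
    have h : σ = ν A := Subtype.ext hA
    rw [h, hYν]
  have hYcongr (σ τ : G3 p g) (h : piRed p σ = piRed p τ) : Y σ = Y τ := by
    have h1 := hY τ (τ⁻¹ * σ)
    rwa [mul_inv_cancel_left, hYker (τ⁻¹ * σ) (by simp [h]), mulVec_zero, add_zero] at h1
  have hYtors (σ) : q • Y σ = 0 := by
    have h1 := hY (ν 1) σ
    have h2 : piRed p (ν 1) = 1 := piRed_oneAddSmulUnit p 1
    rw [hYν, zero_add, hν, one_mulVec, hYcongr (ν 1 * σ) σ (by simp [h2])] at h1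
    simpa using h1
  refine ⟨m₀, fun x ↦ if h : ∃ σ : G3 p g, piRed p σ = x then Y h.choose else 0, fun x ↦ ?_,
    fun σ ↦ ?_⟩
  · dsimp only
    split_ifs with h
    · exact hYtors _
    · exact smul_zero _
  · have h : ∃ τ : G3 p g, piRed p τ = piRed p σ := ⟨σ, rfl⟩
    dsimp only
    rw [dif_pos h, hYcongr _ σ h.choose_spec]
    exact (sub_add_cancel _ _).symm
end
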